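/- arXiv:1801.09213 — 4 statements merged into one kernel-verified Lean document; each statement's English description precedes it below -/
import Mathlib

section
/- Let c₀ denote the Banach space of real sequences converging to 0 with the supremum norm |ξ| = sup_j |x_j|. Let (f_j)_{j≥1} be continuously differentiable functions ℝ → ℝ with f_j(0) = 0 and sup_{u∈ℝ} |f'_j(u)| ≤ 2 for all j. Then the map f : c₀ → c₀ given by f((x_j)_j) = (f_j(x_j))_j is well defined and Lipschitz continuous with constant 2, and f is C¹_MB-smooth with Df(ξ)η = (f'_j(x_j) y_j)_j for ξ = (x_j)_j ∈ c₀ and η = (y_j)_j ∈ c₀. -/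
open Filter Topology ZeroAtInfty

namespace ZeroAtInftyContinuousMap

/-- A function on a discrete space that is dominated by a constant multiple of an element of `C₀`
is itself an element of `C₀`. -/
def ofDominated {α : Type*} [TopologicalSpace α] [DiscreteTopology α] (g : α → ℝ) (C : ℝ)
    (η : C₀(α, ℝ)) (h : ∀ a, |g a| ≤ C * |η a|) : C₀(α, ℝ) where
  toFun := g
  continuous_toFun := continuous_of_discreteTopology
  zero_at_infty' := by
    refine squeeze_zero_norm h ?_
    simpa using (zero_at_infty η).abs.const_mul C

@[simp]
theorem ofDominated_apply {α : Type*} [TopologicalSpace α] [DiscreteTopology α] (g : α → ℝ) (C : ℝ)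
    (η : C₀(α, ℝ)) (h : ∀ a, |g a| ≤ C * |η a|) (a : α) : ofDominated g C η h a = g a :=
  rfl

theorem tendsto_apply {ι α : Type*} [TopologicalSpace α] {l : Filter ι} {G : ι → C₀(α, ℝ)}
    {g : C₀(α, ℝ)} (h : Tendsto G l (𝓝 g)) (a : α) : Tendsto (fun i => G i a) l (𝓝 (g a)) :=
  (tendsto_iff_tendstoUniformly.1 h).tendsto_at a

/-- Dominated convergence in `C₀` of a discrete space: pointwise convergence implies norm
convergence for families dominated by a norm convergent family. -/
theorem tendsto_of_dominated {ι α : Type*} [TopologicalSpace α] [DiscreteTopology α]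
    {l : Filter ι} {G H : ι → C₀(α, ℝ)} {g h : C₀(α, ℝ)}
    (hG : ∀ a, Tendsto (fun i => G i a) l (𝓝 (g a))) (hH : Tendsto H l (𝓝 h))
    (hGH : ∀ᶠ i in l, ∀ a, |G i a| ≤ |H i a|) : Tendsto G l (𝓝 g) := by
  rw [tendsto_iff_tendstoUniformly, Metric.tendstoUniformly_iff] at hH ⊢
  intro ε hε
  have hsmall (k : C₀(α, ℝ)) : ∀ᶠ a in cofinite, |k a| < ε / 3 := by
    have hk := zero_at_infty k
    rw [cocompact_eq_cofinite, Metric.tendsto_nhds] at hk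
    simpa using hk (ε / 3) (by positivity)
  have hfin := (hsmall g).and (hsmall h)
  rw [eventually_cofinite] at hfin
  have hnear := (eventually_all_finite hfin).2 fun a _ => Metric.tendsto_nhds.1 (hG a) ε hε
  filter_upwards [hnear, hH (ε / 3) (by positivity), hGH] with i hi hHi hGHi a
  by_cases ha : |g a| < ε / 3 ∧ |h a| < ε / 3
  · have h₁ := hHi a
    rw [Real.dist_eq] at h₁ ⊢
    have h₂ := hGHi a
    have h₃ := abs_sub (g a) (G i a)
    have h₄ := abs_sub_abs_le_abs_sub (H i a) (h a)
    rw [abs_sub_comm] at h₄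
    linarith [ha.1, ha.2]
  · rw [dist_comm]
    exact hi a ha

end ZeroAtInftyContinuousMap

open ZeroAtInftyContinuousMap

/-- **Proposition 8.1.** Let `c₀ = C₀(ℕ, ℝ)` be the Banach space of real null sequences with
the supremum norm, and let `f_j : ℝ → ℝ` be continuously differentiable with `f_j 0 = 0` and
`|f'_j| ≤ 2` everywhere.  Then `f(ξ) = (f_j(ξ_j))_j` defines a map `c₀ → c₀` which is
Lipschitz with constant `2` and `C¹_MB`-smooth with `Df(ξ)η = (f'_j(ξ_j) η_j)_j`:
all directional derivatives exist and `(ξ,η) ↦ Df(ξ)η` is jointly continuous. -/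
theorem c0_substitution_is_c1MB
    (f : ℕ → ℝ → ℝ) (f' : ℕ → ℝ → ℝ)
    (hderiv : ∀ j : ℕ, ∀ x : ℝ, HasDerivAt (f j) (f' j x) x)
    (hcont : ∀ j : ℕ, Continuous (f' j))
    (h0 : ∀ j : ℕ, f j 0 = 0)
    (hbd : ∀ j : ℕ, ∀ u : ℝ, |f' j u| ≤ 2) :
    ∃ F : C₀(ℕ, ℝ) → C₀(ℕ, ℝ),
      (∀ (ξ : C₀(ℕ, ℝ)) (j : ℕ), F ξ j = f j (ξ j)) ∧
      LipschitzWith 2 F ∧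
      ∃ DF : C₀(ℕ, ℝ) → C₀(ℕ, ℝ) → C₀(ℕ, ℝ),
        (∀ (ξ η : C₀(ℕ, ℝ)) (j : ℕ), DF ξ η j = f' j (ξ j) * η j) ∧
        (∀ ξ η : C₀(ℕ, ℝ),
          Tendsto (fun h : ℝ => h⁻¹ • (F (ξ + h • η) - F ξ)) (𝓝[≠] (0 : ℝ))
            (𝓝 (DF ξ η))) ∧
        Continuous (fun p : C₀(ℕ, ℝ) × C₀(ℕ, ℝ) => DF p.1 p.2) := by
  have hlip (j : ℕ) (x y : ℝ) : |f j x - f j y| ≤ 2 * |x - y| :=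
    convex_univ.norm_image_sub_le_of_norm_hasDerivWithin_le
      (fun z _ => (hderiv j z).hasDerivWithinAt) (fun z _ => hbd j z) (Set.mem_univ y)
      (Set.mem_univ x)
  have hmul (ξ η : C₀(ℕ, ℝ)) (j : ℕ) : |f' j (ξ j) * η j| ≤ 2 * |η j| := by
    rw [abs_mul]
    gcongr
    exact hbd j _
  refine ⟨fun ξ => ofDominated (fun j => f j (ξ j)) 2 ξ fun j => ?_, fun _ _ => rfl, ?_,
    fun ξ η => ofDominated (fun j => f' j (ξ j) * η j) 2 η (hmul ξ η), fun _ _ _ => rfl, ?_, ?_⟩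
  · simpa [h0] using hlip j (ξ j) 0
  · refine LipschitzWith.of_dist_le_mul fun ξ η => ?_
    rw [← dist_toBCF_eq_dist, BoundedContinuousFunction.dist_le (by positivity)]
    intro j
    refine (hlip j (ξ j) (η j)).trans ?_
    rw [← dist_toBCF_eq_dist (f := ξ)]
    exact mul_le_mul_of_nonneg_left
      (BoundedContinuousFunction.dist_coe_le_dist (f := ξ.toBCF) (g := η.toBCF) j) zero_le_two
  · intro ξ η
    refine tendsto_of_dominated (H := fun _ => (2 : ℝ) • η) (fun j => ?_) tendsto_const_nhds ?_
    · have hline : HasDerivAt (fun t : ℝ => ξ j + t * η j) (η j) 0 := by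
        simpa using ((hasDerivAt_id (0 : ℝ)).mul_const (η j)).const_add (ξ j)
      have hcomp := HasDerivAt.comp (h₂ := f j) (h₂' := f' j (ξ j)) 0
        (by simpa using hderiv j (ξ j)) hline
      simpa [Function.comp_def] using hcomp.tendsto_slope_zero
    · filter_upwards [self_mem_nhdsWithin] with t ht j
      have ht' : 0 < |t| := abs_pos.2 ht
      have hle := hlip j (ξ j + t * η j) (ξ j)
      rw [add_sub_cancel_left, abs_mul] at hle
      change |t⁻¹ * (f j (ξ j + t * η j) - f j (ξ j))| ≤ |2 * η j|
      rw [abs_mul, abs_inv, abs_mul, abs_two, inv_mul_le_iff₀ ht']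
      linarith
  · refine continuous_iff_continuousAt.2 fun p => ?_
    refine tendsto_of_dominated (H := fun q => (2 : ℝ) • q.2) (h := (2 : ℝ) • p.2) (fun j => ?_)
      ((continuous_snd.tendsto p).const_smul (2 : ℝ)) (.of_forall fun q j => ?_)
    · exact (((hcont j).tendsto _).comp (tendsto_apply (continuous_fst.tendsto p) j)).mul
        (tendsto_apply (continuous_snd.tendsto p) j)
    · simpa [abs_mul] using hmul q.1 q.2 j
end

section
/- Let ℓ¹ denote the Banach space of absolutely summable real sequences with norm |ξ| = Σ_j |x_j|. Let (f_j)_{j≥1} be continuously differentiable functions ℝ → ℝ with f_j(0) = 0 and sup_{u∈ℝ} |f'_j(u)| ≤ 2 for all j. Then the map f̂ : ℓ¹ → ℓ¹ given by f̂((x_j)_j) = (f_j(x_j))_j is well defined and Lipschitz continuous with constant 2, and f̂ is C¹_MB-smooth with Df̂(ξ)η = (f'_j(x_j) y_j)_j for ξ = (x_j)_j ∈ ℓ¹ and η = (y_j)_j ∈ ℓ¹. -/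
open Filter Topology

theorem memℓp_one_real_iff {ι : Type*} {u : ι → ℝ} : Memℓp u 1 ↔ Summable fun j => |u j| := by
  simpa using memℓp_gen_iff (E := fun _ : ι => ℝ) (p := 1) (f := u) (by simp)

theorem lp_one_real_norm_eq_tsum {ι : Type*} (u : lp (fun _ : ι => ℝ) 1) :
    ‖u‖ = ∑' j, |u j| := by
  simpa using lp.norm_eq_tsum_rpow (p := 1) (by simp) u

theorem lp_one_real_summable_abs {ι : Type*} (u : lp (fun _ : ι => ℝ) 1) :
    Summable fun j => |u j| :=
  memℓp_one_real_iff.1 (lp.memℓp u)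

theorem memℓp_one_real_of_abs_le {ι : Type*} {u : ι → ℝ} {C : ℝ} (v : lp (fun _ : ι => ℝ) 1)
    (h : ∀ j, |u j| ≤ C * |v j|) : Memℓp u 1 :=
  memℓp_one_real_iff.2 <|
    ((lp_one_real_summable_abs v).mul_left C).of_nonneg_of_le (fun _ => abs_nonneg _) h

theorem lp_one_real_norm_le_of_abs_le {ι : Type*} {C : ℝ} (u v : lp (fun _ : ι => ℝ) 1)
    (h : ∀ j, |u j| ≤ C * |v j|) : ‖u‖ ≤ C * ‖v‖ := by
  rw [lp_one_real_norm_eq_tsum, lp_one_real_norm_eq_tsum, ← tsum_mul_left]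
  exact (lp_one_real_summable_abs u).tsum_le_tsum h ((lp_one_real_summable_abs v).mul_left C)

/-- Dominated convergence in `ℓ¹`. -/
theorem lp_one_real_tendsto_of_dominated {ι α : Type*} {l : Filter α}
    {G : α → lp (fun _ : ι => ℝ) 1} {g : lp (fun _ : ι => ℝ) 1} {C : ℝ}
    (v : lp (fun _ : ι => ℝ) 1)
    (hlim : ∀ j, Tendsto (fun a => G a j) l (𝓝 (g j)))
    (hbound : ∀ᶠ a in l, ∀ j, |G a j - g j| ≤ C * |v j|) : Tendsto G l (𝓝 g) := by
  rw [tendsto_iff_norm_sub_tendsto_zero]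
  have key : Tendsto (fun a => ∑' j, |G a j - g j|) l (𝓝 (∑' _ : ι, (0 : ℝ))) := by
    refine tendsto_tsum_of_dominated_convergence ((lp_one_real_summable_abs v).mul_left C)
      (fun j => ?_) ?_
    · simpa using ((hlim j).sub_const (g j)).abs
    · simpa using hbound
  simpa [lp_one_real_norm_eq_tsum] using key

theorem lp_one_real_continuous_apply {ι : Type*} (j : ι) :
    Continuous fun u : lp (fun _ : ι => ℝ) 1 => u j :=
  (continuous_apply j).comp lp.uniformContinuous_coe.continuous

/-- **Proposition 8.3.** Let `ℓ¹ = lp (fun _ : ℕ => ℝ) 1` be the Banach space of absolutely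
summable real sequences and let `f_j : ℝ → ℝ` be continuously differentiable with
`f_j 0 = 0` and `|f'_j| ≤ 2` everywhere.  Then `f̂(ξ) = (f_j(ξ_j))_j` defines a map
`ℓ¹ → ℓ¹` which is Lipschitz with constant `2` and `C¹_MB`-smooth with
`Df̂(ξ)η = (f'_j(ξ_j) η_j)_j`: all directional derivatives exist and `(ξ,η) ↦ Df̂(ξ)η`
is jointly continuous. -/
theorem l1_substitution_is_c1MB
    (f : ℕ → ℝ → ℝ) (f' : ℕ → ℝ → ℝ)
    (hderiv : ∀ j : ℕ, ∀ x : ℝ, HasDerivAt (f j) (f' j x) x)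
    (hcont : ∀ j : ℕ, Continuous (f' j))
    (h0 : ∀ j : ℕ, f j 0 = 0)
    (hbd : ∀ j : ℕ, ∀ u : ℝ, |f' j u| ≤ 2) :
    ∃ F : lp (fun _ : ℕ => ℝ) 1 → lp (fun _ : ℕ => ℝ) 1,
      (∀ (ξ : lp (fun _ : ℕ => ℝ) 1) (j : ℕ), F ξ j = f j (ξ j)) ∧
      LipschitzWith 2 F ∧
      ∃ DF : lp (fun _ : ℕ => ℝ) 1 → lp (fun _ : ℕ => ℝ) 1 → lp (fun _ : ℕ => ℝ) 1,
        (∀ (ξ η : lp (fun _ : ℕ => ℝ) 1) (j : ℕ), DF ξ η j = f' j (ξ j) * η j) ∧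
        (∀ ξ η : lp (fun _ : ℕ => ℝ) 1,
          Tendsto (fun h : ℝ => h⁻¹ • (F (ξ + h • η) - F ξ)) (𝓝[≠] (0 : ℝ))
            (𝓝 (DF ξ η))) ∧
        Continuous
          (fun p : lp (fun _ : ℕ => ℝ) 1 × lp (fun _ : ℕ => ℝ) 1 => DF p.1 p.2) := by
  have hlip (j : ℕ) (x y : ℝ) : |f j x - f j y| ≤ 2 * |x - y| :=
    convex_univ.norm_image_sub_le_of_norm_hasDerivWithin_le
      (fun z _ => (hderiv j z).hasDerivWithinAt) (fun z _ => hbd j z) (Set.mem_univ y)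
      (Set.mem_univ x)
  have hmul (j : ℕ) (x y : ℝ) : |f' j x * y| ≤ 2 * |y| := by
    rw [abs_mul]
    gcongr
    exact hbd j x
  let F (ξ : lp (fun _ : ℕ => ℝ) 1) : lp (fun _ : ℕ => ℝ) 1 :=
    ⟨fun j => f j (ξ j), memℓp_one_real_of_abs_le ξ fun j => by simpa [h0] using hlip j (ξ j) 0⟩
  let DF (ξ η : lp (fun _ : ℕ => ℝ) 1) : lp (fun _ : ℕ => ℝ) 1 :=
    ⟨fun j => f' j (ξ j) * η j, memℓp_one_real_of_abs_le η fun j => hmul j (ξ j) (η j)⟩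
  have hF (ξ : lp (fun _ : ℕ => ℝ) 1) (j : ℕ) : F ξ j = f j (ξ j) := rfl
  have hDF (ξ η : lp (fun _ : ℕ => ℝ) 1) (j : ℕ) : DF ξ η j = f' j (ξ j) * η j := rfl
  refine ⟨F, hF, LipschitzWith.of_dist_le_mul fun ξ η => ?_, DF, hDF, fun ξ η => ?_, ?_⟩
  · rw [dist_eq_norm, dist_eq_norm]
    exact lp_one_real_norm_le_of_abs_le _ _ fun j => hlip j (ξ j) (η j)
  · refine lp_one_real_tendsto_of_dominated (C := 4) η (fun j => ?_) ?_
    · have hline : HasDerivAt (fun h : ℝ => f j (ξ j + h * η j)) (f' j (ξ j) * η j) 0 := by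
        refine HasDerivAt.comp (0 : ℝ) (h₂ := f j) (by simpa using hderiv j (ξ j)) ?_
        simpa using ((hasDerivAt_id (0 : ℝ)).mul_const (η j)).const_add (ξ j)
      have hslope := hline.tendsto_slope_zero
      simp only [zero_add, zero_mul, add_zero] at hslope
      exact hslope
    · filter_upwards [self_mem_nhdsWithin] with h hh j
      have hh : 0 < |h| := abs_pos.2 hh
      have hquot : |h⁻¹ * (f j (ξ j + h * η j) - f j (ξ j))| ≤ 2 * |η j| := by
        rw [abs_mul, abs_inv, inv_mul_le_iff₀ hh]
        have := hlip j (ξ j + h * η j) (ξ j)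
        rw [add_sub_cancel_left, abs_mul] at this
        linarith
      calc |h⁻¹ * (f j (ξ j + h * η j) - f j (ξ j)) - f' j (ξ j) * η j|
          ≤ |h⁻¹ * (f j (ξ j + h * η j) - f j (ξ j))| + |f' j (ξ j) * η j| := abs_sub _ _
        _ ≤ 4 * |η j| := by linarith [hmul j (ξ j) (η j)]
  · rw [continuous_iff_continuousAt]
    rintro ⟨ξ₀, η₀⟩
    have hsplit (ξ η : lp (fun _ : ℕ => ℝ) 1) : DF ξ η = DF ξ (η - η₀) + DF ξ η₀ := by
      ext j
      simp only [hDF, lp.coeFn_add, lp.coeFn_sub, Pi.add_apply, Pi.sub_apply]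
      ring
    have hincr : Tendsto (fun p : lp (fun _ : ℕ => ℝ) 1 × lp (fun _ : ℕ => ℝ) 1 =>
        DF p.1 (p.2 - η₀)) (𝓝 (ξ₀, η₀)) (𝓝 0) := by
      refine squeeze_zero_norm (a := fun p => 2 * ‖p.2 - η₀‖)
        (fun p => lp_one_real_norm_le_of_abs_le _ _ fun j => hmul j (p.1 j) _) ?_
      have : Continuous fun p : lp (fun _ : ℕ => ℝ) 1 × lp (fun _ : ℕ => ℝ) 1 =>
        2 * ‖p.2 - η₀‖ := by fun_prop
      simpa using this.tendsto (ξ₀, η₀)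
    have hbase : Tendsto (fun p : lp (fun _ : ℕ => ℝ) 1 × lp (fun _ : ℕ => ℝ) 1 =>
        DF p.1 η₀) (𝓝 (ξ₀, η₀)) (𝓝 (DF ξ₀ η₀)) := by
      refine lp_one_real_tendsto_of_dominated (C := 4) η₀ (fun j => ?_)
        (Eventually.of_forall fun p j => ?_)
      · exact ((((hcont j).comp (lp_one_real_continuous_apply j)).comp
          continuous_fst).mul_const (η₀ j)).tendsto (ξ₀, η₀)
      · calc |f' j (p.1 j) * η₀ j - f' j (ξ₀ j) * η₀ j|
            ≤ |f' j (p.1 j) * η₀ j| + |f' j (ξ₀ j) * η₀ j| := abs_sub _ _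
          _ ≤ 4 * |η₀ j| := by linarith [hmul j (p.1 j) (η₀ j), hmul j (ξ₀ j) (η₀ j)]
    have hsum := hincr.add hbase
    rw [zero_add] at hsum
    exact hsum.congr fun p => (hsplit p.1 p.2).symm
end

section
/- Let ℓ¹ be the Banach space of absolutely summable real sequences, and let (f_j)_{j≥1} be continuously differentiable functions ℝ → ℝ with f_j(0) = 0, sup_{u∈ℝ} |f'_j(u)| ≤ 2, f'_j(0) = 0, and f'_j(1/j) = 1 for all j. Let s : ℓ¹ → ℝ be the continuous linear map s((ξ_j)_j) = Σ_j ξ_j, and let f̂ : ℓ¹ → ℓ¹ be given by f̂((x_j)_j) = (f_j(x_j))_j, so that D(s∘f̂)(ξ)η = Σ_j f'_j(x_j) y_j. Then D(s∘f̂)(0) = 0, and for the sequence ξ_k = (1/k)·e_k (e_k the k-th standard unit sequence), which converges to 0 in ℓ¹, one has ‖D(s∘f̂)(ξ_k) − D(s∘f̂)(0)‖ ≥ 1 for all k in the norm of L(ℓ¹,ℝ); hence s∘f̂ : ℓ¹ → ℝ is not C¹_F-smooth. -/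
open Filter Topology

/-- **(Section 8: `s ∘ f̂` is not `C¹_F`.)** Let `ℓ¹ = lp (fun _ : ℕ => ℝ) 1`, let
`f_j : ℝ → ℝ` be continuously differentiable with `f_j 0 = 0`, `|f'_j| ≤ 2`, `f'_j 0 = 0`
and `f'_j (1/j) = 1` for `j ≥ 1`, let `s : ℓ¹ → ℝ` be the summation functional and let
`D ξ : ℓ¹ →L[ℝ] ℝ` be the Gateaux derivative `η ↦ Σ_j f'_j(ξ_j) η_j` of `s ∘ f̂` at `ξ`,
where `f̂(ξ) = (f_j(ξ_j))_j`.  Then `D 0 = 0`, the points `ξ_k = (1/k) • e_k` (with `e_k`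
the `k`-th unit sequence) tend to `0` in `ℓ¹`, while `‖D ξ_k - D 0‖ ≥ 1` for all `k ≥ 1`;
in particular `D` is not continuous, so `s ∘ f̂` is not `C¹_F`-smooth. -/
theorem l1_sum_substitution_not_c1F
    (f : ℕ → ℝ → ℝ) (f' : ℕ → ℝ → ℝ)
    (hderiv : ∀ j : ℕ, ∀ x : ℝ, HasDerivAt (f j) (f' j x) x)
    (hcont : ∀ j : ℕ, Continuous (f' j))
    (h0 : ∀ j : ℕ, f j 0 = 0)
    (hbd : ∀ j : ℕ, ∀ u : ℝ, |f' j u| ≤ 2)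
    (h'0 : ∀ j : ℕ, f' j 0 = 0)
    (h'1 : ∀ j : ℕ, 1 ≤ j → f' j (1 / (j : ℝ)) = 1)
    (s : lp (fun _ : ℕ => ℝ) 1 →L[ℝ] ℝ)
    (hs : ∀ ξ : lp (fun _ : ℕ => ℝ) 1, s ξ = ∑' j : ℕ, ξ j)
    (e : ℕ → lp (fun _ : ℕ => ℝ) 1)
    (he : ∀ k j : ℕ, e k j = if j = k then (1 : ℝ) else 0)
    (D : lp (fun _ : ℕ => ℝ) 1 → lp (fun _ : ℕ => ℝ) 1 →L[ℝ] ℝ)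
    (hD : ∀ ξ η : lp (fun _ : ℕ => ℝ) 1, D ξ η = ∑' j : ℕ, f' j (ξ j) * η j) :
    D 0 = 0 ∧
    Tendsto (fun k : ℕ => (1 / (k : ℝ)) • e k) atTop (𝓝 (0 : lp (fun _ : ℕ => ℝ) 1)) ∧
    (∀ k : ℕ, 1 ≤ k → 1 ≤ ‖D ((1 / (k : ℝ)) • e k) - D 0‖) ∧
    ¬ Continuous D := by
  have hsingle : ∀ k : ℕ, e k = lp.single 1 k (1 : ℝ) := fun k => by
    ext j
    simp [he, lp.single_apply, Pi.single_apply]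
  have hnorm : ∀ k : ℕ, ‖e k‖ = 1 := fun k => by
    rw [hsingle, lp.norm_single one_pos, norm_one]
  have hD0 : D 0 = 0 := by
    ext η
    simp [hD, h'0]
  have htend : Tendsto (fun k : ℕ => (1 / (k : ℝ)) • e k) atTop
      (𝓝 (0 : lp (fun _ : ℕ => ℝ) 1)) := by
    rw [tendsto_zero_iff_norm_tendsto_zero]
    simpa [norm_smul, hnorm] using tendsto_inv_atTop_nhds_zero_nat (𝕜 := ℝ)
  have hlow : ∀ k : ℕ, 1 ≤ k → 1 ≤ ‖D ((1 / (k : ℝ)) • e k) - D 0‖ := fun k hk => by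
    have hval : D ((1 / (k : ℝ)) • e k) (e k) = 1 := by
      rw [hD, tsum_eq_single k fun j hj => by simp [he, hj]]
      simpa [he] using h'1 k hk
    have hle := (D ((1 / (k : ℝ)) • e k)).le_opNorm (e k)
    rw [hD0, sub_zero]
    rwa [hval, hnorm, norm_one, mul_one] at hle
  refine ⟨hD0, htend, hlow, fun hDcont => ?_⟩
  have hlim : Tendsto (fun k : ℕ => ‖D ((1 / (k : ℝ)) • e k) - D 0‖) atTop (𝓝 0) :=
    tendsto_iff_norm_sub_tendsto_zero.mp ((hDcont.tendsto 0).comp htend)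
  exact absurd (ge_of_tendsto hlim (eventually_atTop.mpr ⟨1, hlow⟩)) (by norm_num)
end

section
/- Let T ∈ ℝ and let φ : (-∞,T] → ℝⁿ be continuously differentiable with derivative φ'. Then the curve Φ : (-∞,T) → C((-∞,0],ℝⁿ), Φ(t) = φ_t, is continuously differentiable with Φ'(t) = (φ')_t; that is, for every t < T the limit lim_{h→0, h≠0} (φ_{t+h} − φ_t)/h exists in C((-∞,0],ℝⁿ) with its compact-open topology and equals (φ')_t, and the map t ↦ (φ')_t is continuous on (-∞,T). -/
open Filter Topology

/-- Mean value estimate for the error of the difference quotient. -/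
theorem norm_inv_smul_sub_sub_le_of_hasDerivWithinAt {E : Type*} [NormedAddCommGroup E]
    [NormedSpace ℝ E] {f f' : ℝ → E} {c : E} {x h C : ℝ} {S : Set ℝ} (hh : h ≠ 0)
    (hS : Set.uIcc x (x + h) ⊆ S) (hf : ∀ y ∈ S, HasDerivWithinAt f (f' y) S y)
    (hC : ∀ y ∈ Set.uIcc x (x + h), ‖f' y - c‖ ≤ C) :
    ‖h⁻¹ • (f (x + h) - f x) - c‖ ≤ C := by
  have hderiv : ∀ y ∈ Set.uIcc x (x + h),
      HasDerivWithinAt (fun y => f y - y • c) (f' y - c) (Set.uIcc x (x + h)) y := by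
    intro y hy
    simpa using ((hf y (hS hy)).mono hS).fun_sub ((hasDerivWithinAt_id y _).smul_const c)
  have hmv := (convex_uIcc x (x + h)).norm_image_sub_le_of_norm_hasDerivWithin_le hderiv hC
    Set.left_mem_uIcc Set.right_mem_uIcc
  have heq : h⁻¹ • (f (x + h) - f x) - c = h⁻¹ • (f (x + h) - (x + h) • c - (f x - x • c)) := by
    have : f (x + h) - (x + h) • c - (f x - x • c) = f (x + h) - f x - h • c := by module
    rw [this, smul_sub h⁻¹ _ (h • c), inv_smul_smul₀ hh]
  rw [heq, norm_smul, norm_inv, inv_mul_le_iff₀ (norm_pos_iff.mpr hh), mul_comm]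
  simpa using hmv

/-- **(Proposition 10.1 (ii).)** Let `φ : (-∞,T] → ℝⁿ` be continuously differentiable with
derivative `φ'` (here realized as functions on `ℝ`, differentiable within `(-∞,T]` at each
point of `(-∞,T]`, with `φ'` continuous on `(-∞,T]`).  Then the segment curve
`Φ : (-∞,T) → C((-∞,0],ℝⁿ)`, `Φ(t) = φ_t`, is continuously differentiable with
`Φ'(t) = (φ')_t`: for every `t < T` the limit of `(φ_{t+h} - φ_t)/h` as `0 ≠ h → 0` exists
in `C((-∞,0],ℝⁿ)` (compact-open topology) and equals `(φ')_t`, and `t ↦ (φ')_t` is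
continuous on `(-∞,T)`. -/
theorem segment_curve_continuously_differentiable
    {n : ℕ} (T : ℝ) (φ φ' : ℝ → Fin n → ℝ)
    (hφ : ∀ t ∈ Set.Iic T, HasDerivWithinAt φ (φ' t) (Set.Iic T) t)
    (hφ' : ContinuousOn φ' (Set.Iic T))
    (Φ Ψ : ℝ → C(Set.Iic (0 : ℝ), Fin n → ℝ))
    (hΦ : ∀ (t : ℝ) (s : Set.Iic (0 : ℝ)), Φ t s = φ (t + (s : ℝ)))
    (hΨ : ∀ (t : ℝ) (s : Set.Iic (0 : ℝ)), Ψ t s = φ' (t + (s : ℝ))) :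
    (∀ t < T, Tendsto (fun h : ℝ => h⁻¹ • (Φ (t + h) - Φ t)) (𝓝[≠] (0 : ℝ))
      (𝓝 (Ψ t))) ∧
    ContinuousOn Ψ (Set.Iio T) := by
  have hcont : ContinuousOn Ψ (Set.Iio T) := by
    rw [continuousOn_iff_continuous_domRestrict]
    refine ContinuousMap.continuous_of_continuous_uncurry _ ?_
    have : Continuous fun p : Set.Iio T × Set.Iic (0 : ℝ) => φ' ((p.1 : ℝ) + (p.2 : ℝ)) := by
      refine hφ'.comp_continuous (by fun_prop) fun p => ?_
      have h₁ : (p.1 : ℝ) < T := p.1.2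
      have h₂ : (p.2 : ℝ) ≤ 0 := p.2.2
      exact Set.mem_Iic.mpr (by linarith)
    simpa only [Function.uncurry_def, Set.domRestrict_apply, hΨ] using this
  refine ⟨fun t ht => ?_, hcont⟩
  have hΨt : Tendsto Ψ (𝓝 t) (𝓝 (Ψ t)) := hcont.continuousAt (Iio_mem_nhds ht)
  rw [ContinuousMap.tendsto_iff_forall_isCompact_tendstoUniformlyOn] at hΨt ⊢
  intro K hK
  rw [Metric.tendstoUniformlyOn_iff]
  intro ε hε
  obtain ⟨δ, hδ, hball⟩ := Metric.eventually_nhds_iff.mp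
    (Metric.tendstoUniformlyOn_iff.mp (hΨt K hK) (ε / 2) (half_pos hε))
  have hsmall : ∀ᶠ h : ℝ in 𝓝 0, |h| < min δ (T - t) := by
    filter_upwards [Metric.ball_mem_nhds (0 : ℝ) (lt_min hδ (sub_pos.mpr ht))] with h hh
    rwa [mem_ball_zero_iff, Real.norm_eq_abs] at hh
  filter_upwards [nhdsWithin_le_nhds hsmall, self_mem_nhdsWithin] with h hlt hne s hs
  obtain ⟨hlt₁, hlt₂⟩ := lt_min_iff.mp hlt
  have hs₀ : (s : ℝ) ≤ 0 := s.2
  rw [dist_comm, dist_eq_norm]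
  refine lt_of_le_of_lt ?_ (half_lt_self hε)
  have key := norm_inv_smul_sub_sub_le_of_hasDerivWithinAt (x := t + s) (c := φ' (t + s))
    (C := ε / 2) hne (fun y hy => ?_) hφ fun y hy => ?_
  · simpa [hΦ, hΨ, add_right_comm] using key
  · have := Set.abs_sub_left_of_mem_uIcc hy
    rw [add_sub_cancel_left] at this
    exact Set.mem_Iic.mpr (by linarith [le_abs_self (y - (t + s))])
  · have := Set.abs_sub_left_of_mem_uIcc hy
    rw [add_sub_cancel_left] at this
    have hd := hball (y := y - s) (by
      rw [Real.dist_eq, sub_sub, add_comm (s : ℝ)]; linarith) s hs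
    rw [hΨ, hΨ, sub_add_cancel, dist_comm, dist_eq_norm] at hd
    exact hd.le
end
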